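/- Let λ > 0, let f : ℝ^{d×d} → ℝ^d be λ-Lipschitz (with respect to the Frobenius norm on ℝ^{d×d} and the Euclidean norm on ℝ^d), let f⁰ ∈ ℝ^d and π ≥ 0 with |f(0) − f⁰| ≤ π. For a positive integer n define q_n(z) = z · n/(|z| ∨ n) and f_n(z) = ( f(q_n(z)) − f⁰ ) · n/(π ∨ n) + f⁰. Then for all positive integers n ≤ m and all z ∈ ℝ^{d×d}: |f_m(z) − f_n(z)| ≤ 2λ|z| 1_{{|z| > n}} + 2λ|z| 1_{{π > n}} + 2π 1_{{π > n}}. -/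

import Mathlib

/-- The truncation factor `k / max x k` lies in `[0, 1]`. -/
lemma div_max_mem_Icc (x : ℝ) {k : ℝ} (hk : 0 < k) : k / max x k ∈ Set.Icc (0 : ℝ) 1 :=
  ⟨div_nonneg hk.le (hk.le.trans (le_max_right _ _)),
    div_le_one_of_le₀ (le_max_right _ _) (hk.le.trans (le_max_right _ _))⟩

/-- The truncation factors at levels `k ≤ l` agree unless `k < x`, and differ by at most one. -/
lemma abs_div_max_sub_div_max_le (x : ℝ) {k l : ℝ} (hk : 0 < k) (hkl : k ≤ l) :
    |l / max x l - k / max x k| ≤ if k < x then 1 else 0 := by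
  have hl : 0 < l := hk.trans_le hkl
  split_ifs with h
  · obtain ⟨h0, h1⟩ := div_max_mem_Icc x hk
    obtain ⟨h2, h3⟩ := div_max_mem_Icc x hl
    rw [abs_le]
    constructor <;> linarith
  · rw [not_lt] at h
    rw [max_eq_right h, max_eq_right (h.trans hkl), div_self hk.ne', div_self hl.ne']
    simp

/-- Comparison of two rescaled values `a • (f (b • z) - y) + y` of a Lipschitz map. -/
lemma norm_smul_sub_add_sub_le {E F : Type*} [NormedAddCommGroup E] [NormedSpace ℝ E]
    [NormedAddCommGroup F] [NormedSpace ℝ F] {f : E → F} {K r : ℝ} (hK : 0 ≤ K)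
    (hf : ∀ z₁ z₂, ‖f z₁ - f z₂‖ ≤ K * ‖z₁ - z₂‖) {y : F} (hy : ‖f 0 - y‖ ≤ r)
    {a a' b b' : ℝ} (ha : a ∈ Set.Icc (0 : ℝ) 1) (hb' : b' ∈ Set.Icc (0 : ℝ) 1) (z : E) :
    ‖(a • (f (b • z) - y) + y) - (a' • (f (b' • z) - y) + y)‖
      ≤ K * ‖z‖ * |b - b'| + (K * ‖z‖ + r) * |a - a'| := by
  have h₁ : ‖f (b • z) - f (b' • z)‖ ≤ K * ‖z‖ * |b - b'| := by
    refine (hf _ _).trans_eq ?_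
    rw [← sub_smul, norm_smul, Real.norm_eq_abs]
    ring
  have h₂ : ‖f (b' • z) - y‖ ≤ K * ‖z‖ + r := by
    have hz : ‖f (b' • z) - f 0‖ ≤ K * ‖z‖ := by
      refine (hf _ _).trans (mul_le_mul_of_nonneg_left ?_ hK)
      rw [sub_zero, norm_smul, Real.norm_of_nonneg hb'.1]
      exact mul_le_of_le_one_left (norm_nonneg z) hb'.2
    exact (norm_sub_le_norm_sub_add_norm_sub _ (f 0) _).trans (add_le_add hz hy)
  calc ‖(a • (f (b • z) - y) + y) - (a' • (f (b' • z) - y) + y)‖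
      = ‖a • (f (b • z) - f (b' • z)) + (a - a') • (f (b' • z) - y)‖ := by
        congr 1
        module
    _ ≤ a * ‖f (b • z) - f (b' • z)‖ + |a - a'| * ‖f (b' • z) - y‖ := by
        refine (norm_add_le _ _).trans_eq ?_
        rw [norm_smul, norm_smul, Real.norm_of_nonneg ha.1, Real.norm_eq_abs]
    _ ≤ K * ‖z‖ * |b - b'| + (K * ‖z‖ + r) * |a - a'| := by
        rw [mul_comm |a - a'|]
        exact add_le_add ((mul_le_of_le_one_left (norm_nonneg _) ha.2).trans h₁)
          (mul_le_mul_of_nonneg_right h₂ (abs_nonneg _))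


/-- for `λ`-Lipschitz `f`, `f⁰` with `|f(0) − f⁰| ≤ π`, `π ≥ 0`, and
`f_n(z) = (f(q_n(z)) − f⁰) n/(π ∨ n) + f⁰` where `q_n(z) = z n/(|z| ∨ n)`, for all
positive `n ≤ m` and all `z`:
`|f_m(z) − f_n(z)| ≤ 2λ|z| 1_{|z| > n} + 2λ|z| 1_{π > n} + 2π 1_{π > n}`. -/
theorem stmt_16 (d : ℕ) (lam pi : ℝ) (hlam : 0 < lam) (hpi : 0 ≤ pi)
    (f : EuclideanSpace ℝ (Fin d × Fin d) → EuclideanSpace ℝ (Fin d))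
    (hf : ∀ z₁ z₂, ‖f z₁ - f z₂‖ ≤ lam * ‖z₁ - z₂‖)
    (f0 : EuclideanSpace ℝ (Fin d)) (hf0 : ‖f 0 - f0‖ ≤ pi) :
    ∀ n m : ℕ, 0 < n → n ≤ m → ∀ z : EuclideanSpace ℝ (Fin d × Fin d),
      ‖(((m : ℝ) / max pi (m : ℝ)) • (f (((m : ℝ) / max ‖z‖ (m : ℝ)) • z) - f0) + f0)
          - (((n : ℝ) / max pi (n : ℝ)) • (f (((n : ℝ) / max ‖z‖ (n : ℝ)) • z) - f0) + f0)‖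
        ≤ 2 * lam * ‖z‖ * (if (n : ℝ) < ‖z‖ then 1 else 0)
          + 2 * lam * ‖z‖ * (if (n : ℝ) < pi then 1 else 0)
          + 2 * pi * (if (n : ℝ) < pi then 1 else 0) := by
  intro n m hn hnm z
  have hn' : (0 : ℝ) < n := Nat.cast_pos.2 hn
  have hnm' : (n : ℝ) ≤ m := Nat.cast_le.2 hnm
  have hz : 0 ≤ lam * ‖z‖ := mul_nonneg hlam.le (norm_nonneg z)
  have hind : ∀ x : ℝ, (0 : ℝ) ≤ if (n : ℝ) < x then 1 else 0 := fun x => by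
    split_ifs <;> norm_num
  have h := norm_smul_sub_add_sub_le hlam.le hf hf0 (a' := n / max pi n) (b := m / max ‖z‖ m)
    (div_max_mem_Icc pi (hn'.trans_le hnm')) (div_max_mem_Icc ‖z‖ hn') z
  have h₁ := mul_le_mul_of_nonneg_left (abs_div_max_sub_div_max_le ‖z‖ hn' hnm') hz
  have h₂ := mul_le_mul_of_nonneg_left (abs_div_max_sub_div_max_le pi hn' hnm') (add_nonneg hz hpi)
  linarith [mul_nonneg hz (hind ‖z‖), mul_nonneg (add_nonneg hz hpi) (hind pi)]
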